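/- arXiv:1309.3066 — 3 statements merged into one kernel-verified Lean document; each statement's English description precedes it below -/
import Mathlib

section
/- Let V be a countable type with the discrete σ-algebra, κ a Markov kernel from V to V, and (X_k)_{k≥0} the canonical discrete-time Markov chain with transition kernel κ; write P_ν for its law from initial distribution ν and P_x = P_{δ_x}. Suppose x ∈ V is transient, i.e. ∑_{k=1}^{∞} P_x(X_k = x) < ∞. Then for every probability measure μ on V and every sequence (θ_n) of positive integers with θ_n → ∞ one has lim_{n→∞} ∑_{k=1}^{∞} P_μ(X_{kθ_n} = x) = 0; in particular (taking μ = δ_x) lim_{n→∞} ∑_{k=1}^{∞} P_x(X_{kθ_n} = x) = 0, so these sums are uniformly bounded in n. -/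
open MeasureTheory ProbabilityTheory Filter Set ENNReal

/-- The law of `X_k`, the canonical discrete-time Markov chain on a countable discrete state
space `V` with transition kernel `κ`, started from the initial distribution `ν`: it is obtained
by iterating the kernel, `P_ν(X_0 ∈ ·) = ν` and `P_ν(X_{k+1} ∈ ·) = P_ν(X_k ∈ ·).bind κ`. -/
noncomputable def chainLaw {V : Type*} [MeasurableSpace V]
    (κ : Kernel V V) (ν : Measure V) : ℕ → Measure V
  | 0 => ν
  | (k + 1) => (chainLaw κ ν k).bind κ

/-- The action `f ↦ (y ↦ ∫⁻ z, f z ∂κ y)` of a transition kernel on nonnegative functions. -/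
noncomputable def transitionOp {V : Type*} [MeasurableSpace V] (κ : Kernel V V)
    (f : V → ℝ≥0∞) (y : V) : ℝ≥0∞ :=
  ∫⁻ z, f z ∂κ y

section

variable {V : Type*} [MeasurableSpace V] [DiscreteMeasurableSpace V]

lemma lintegral_chainLaw (κ : Kernel V V) (ν : Measure V) (k : ℕ) (f : V → ℝ≥0∞) :
    ∫⁻ z, f z ∂chainLaw κ ν k = ∫⁻ y, (transitionOp κ)^[k] f y ∂ν := by
  induction k generalizing f with
  | zero => rfl
  | succ k ih =>
    rw [chainLaw, Measure.lintegral_bind κ.measurable.aemeasurable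
      Measurable.of_discrete.aemeasurable, Function.iterate_succ_apply]
    exact ih (transitionOp κ f)

lemma chainLaw_singleton (κ : Kernel V V) (ν : Measure V) (k : ℕ) (x : V) :
    chainLaw κ ν k {x} = ∫⁻ y, (transitionOp κ)^[k] (indicator {x} 1) y ∂ν := by
  rw [← lintegral_chainLaw, lintegral_indicator_one (MeasurableSet.of_discrete)]

/-- Maximum principle: the expected number of visits to `x` before time `n` is largest when the
chain starts at `x`. -/
lemma sum_iterate_transitionOp_le (κ : Kernel V V) [IsMarkovKernel κ] (x : V) (n : ℕ) (y : V) :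
    ∑ k ∈ Finset.range n, (transitionOp κ)^[k] (indicator {x} 1) y ≤
      ∑' k, chainLaw κ (Measure.dirac x) k {x} := by
  induction n generalizing y with
  | zero => simp
  | succ n ih =>
    by_cases hy : y = x
    · subst hy
      simp_rw [chainLaw_singleton, lintegral_dirac]
      exact ENNReal.sum_le_tsum _
    · rw [Finset.sum_range_succ']
      simp_rw [Function.iterate_succ_apply', transitionOp]
      rw [← lintegral_finsetSum _ fun _ _ ↦ Measurable.of_discrete]
      simpa [hy] using (lintegral_mono ih).trans_eq (lintegral_const (μ := κ y) _)

/-- The expected number of visits to `x` from any initial distribution is at most that of the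
chain started at `x`. -/
lemma tsum_chainLaw_singleton_le (κ : Kernel V V) [IsMarkovKernel κ] (x : V)
    (μ : Measure V) [IsProbabilityMeasure μ] :
    ∑' k, chainLaw κ μ k {x} ≤ ∑' k, chainLaw κ (Measure.dirac x) k {x} := by
  refine ENNReal.tsum_le_of_sum_range_le fun n ↦ ?_
  simp_rw [chainLaw_singleton κ μ]
  rw [← lintegral_finsetSum _ fun _ _ ↦ Measurable.of_discrete]
  simpa using (lintegral_mono (sum_iterate_transitionOp_le κ x n)).trans_eq
    (lintegral_const (μ := μ) _)

end

/-- The sum of a summable sequence along the positive multiples of `m` vanishes as `m → ∞`. -/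
lemma tendsto_tsum_multiples_atTop_zero {a : ℕ → ℝ≥0∞} (ha : ∑' k, a k ≠ ⊤) :
    Tendsto (fun m ↦ ∑' k, a ((k + 1) * m)) atTop (nhds 0) := by
  refine tendsto_of_tendsto_of_tendsto_of_le_of_le' tendsto_const_nhds
    (ENNReal.tendsto_sum_nat_add a ha) (Eventually.of_forall fun _ ↦ zero_le) ?_
  filter_upwards [eventually_gt_atTop 0] with m hm
  simp_rw [add_one_mul]
  exact ENNReal.tsum_comp_le_tsum_of_injective (mul_left_injective₀ hm.ne')
    fun k ↦ a (k + m)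

/-- If `x` is transient, i.e. `∑_{k=1}^∞ P_x(X_k = x) < ∞`, then for every initial probability
distribution `μ` and every sequence `θ_n → ∞` of positive integers,
`∑_{k=1}^∞ P_μ(X_{k θ_n} = x) → 0` as `n → ∞`. -/
theorem transient_sparse_visits_tendsto_zero
    {V : Type*} [Countable V] [MeasurableSpace V] [DiscreteMeasurableSpace V]
    (κ : Kernel V V) [IsMarkovKernel κ] (x : V)
    (h_trans : ∑' k : ℕ, chainLaw κ (Measure.dirac x) (k + 1) {x} < ⊤) :
    ∀ μ : Measure V, IsProbabilityMeasure μ →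
      ∀ θ : ℕ → ℕ, (∀ n, 0 < θ n) → Tendsto θ atTop atTop →
        Tendsto (fun n => ∑' k : ℕ, chainLaw κ μ ((k + 1) * θ n) {x})
          atTop (nhds 0) := by
  intro μ _ θ _ hθ
  refine (tendsto_tsum_multiples_atTop_zero (ne_top_of_le_ne_top ?_
    (tsum_chainLaw_singleton_le κ x μ))).comp hθ
  rw [tsum_eq_zero_add' ENNReal.summable]
  simpa [chainLaw] using h_trans.ne
end

section
/- Let c ∈ [0,∞) and let p : ℝ → ℝ be a measurable function with p(t) ≥ 0 for all t ≥ 0 and satisfying the regularity property p(t+s) ≥ e^{−c s} p(t) for all t ≥ 0 and s ≥ 0. Assume ∫_0^∞ p(t) dt < ∞. Then for every real θ ≥ 1 one has ∑_{k=1}^{∞} p(kθ) ≤ e^{c} ∫_{θ}^{∞} p(t) dt. Consequently, for every sequence (θ_n) of reals with θ_n ≥ 1 and θ_n → ∞, lim_{n→∞} ∑_{k=1}^{∞} p(kθ_n) = 0. -/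
open MeasureTheory Filter Set

/-- Under the regularity condition, a value of `p` is controlled by the integral of `p` over any
interval of length at least one starting there. -/
lemma le_exp_mul_intervalIntegral_of_regular
    {c : ℝ} (hc : 0 ≤ c) {p : ℝ → ℝ} (hp_nonneg : ∀ t : ℝ, 0 ≤ t → 0 ≤ p t)
    (hp_reg : ∀ t : ℝ, 0 ≤ t → ∀ s : ℝ, 0 ≤ s → Real.exp (-c * s) * p t ≤ p (t + s))
    (hp_int : IntegrableOn p (Ioi (0 : ℝ)) volume) {a b : ℝ} (ha : 0 ≤ a) (hab : a + 1 ≤ b) :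
    p a ≤ Real.exp c * ∫ t in a..b, p t := by
  have hint : ∀ x, a ≤ x → IntervalIntegrable p volume a x := fun x hx =>
    (intervalIntegrable_iff_integrableOn_Ioc_of_le hx).2
      (hp_int.mono_set fun t ht => lt_of_le_of_lt ha ht.1)
  have hunit : Real.exp (-c) * p a ≤ ∫ t in a..(a + 1), p t := by
    calc Real.exp (-c) * p a = ∫ _ in a..(a + 1), Real.exp (-c) * p a := by simp
      _ ≤ ∫ t in a..(a + 1), p t := by
        refine intervalIntegral.integral_mono_on (by linarith) (by simp)
          (hint _ (by linarith)) fun t ht => ?_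
        have h := hp_reg a ha (t - a) (by linarith [ht.1])
        rw [add_sub_cancel] at h
        refine le_trans (mul_le_mul_of_nonneg_right (Real.exp_le_exp.2 ?_) (hp_nonneg a ha)) h
        nlinarith [ht.2]
  have hmono : ∫ t in a..(a + 1), p t ≤ ∫ t in a..b, p t := by
    refine intervalIntegral.integral_mono_interval le_rfl (by linarith) hab ?_
      (hint b (by linarith))
    filter_upwards [ae_restrict_mem measurableSet_Ioc] with t ht
    exact hp_nonneg t (ha.trans ht.1.le)
  calc p a = Real.exp c * (Real.exp (-c) * p a) := by
        rw [← mul_assoc, ← Real.exp_add, add_neg_cancel, Real.exp_zero, one_mul]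
    _ ≤ Real.exp c * ∫ t in a..b, p t :=
        mul_le_mul_of_nonneg_left (hunit.trans hmono) (Real.exp_pos c).le

/-- The tail integrals of an integrable function vanish at infinity. -/
lemma tendsto_setIntegral_Ioi_atTop_zero {p : ℝ → ℝ} {a : ℝ}
    (hp : IntegrableOn p (Ioi a) volume) :
    Tendsto (fun x => ∫ t in Ioi x, p t) atTop (nhds 0) := by
  have h := (intervalIntegral_tendsto_integral_Ioi a hp tendsto_id).const_sub (∫ t in Ioi a, p t)
  rw [sub_self] at h
  refine h.congr' ?_
  filter_upwards [eventually_ge_atTop a] with x hx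
  have := intervalIntegral.integral_Ioi_sub_Ioi hp hx
  simp only [id]
  linarith

/-- Tail-sum bound along sparse times for a nonnegative, integrable function `p` on `[0,∞)`
satisfying the regularity `p (t+s) ≥ exp (-c s) * p t`, together with the resulting
vanishing of the sparse sums along any sequence `θ_n ≥ 1` tending to infinity. -/
theorem sparse_time_tail_sum_vanishes
    (c : ℝ) (hc : 0 ≤ c) (p : ℝ → ℝ) (hp_meas : Measurable p)
    (hp_nonneg : ∀ t : ℝ, 0 ≤ t → 0 ≤ p t)
    (hp_reg : ∀ t : ℝ, 0 ≤ t → ∀ s : ℝ, 0 ≤ s → Real.exp (-c * s) * p t ≤ p (t + s))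
    (hp_int : IntegrableOn p (Ioi (0 : ℝ)) volume) :
    (∀ θ : ℝ, 1 ≤ θ →
      ∑' k : ℕ, p ((k + 1 : ℕ) * θ) ≤ Real.exp c * ∫ t in Ioi θ, p t) ∧
    (∀ θseq : ℕ → ℝ, (∀ n, 1 ≤ θseq n) → Tendsto θseq atTop atTop →
      Tendsto (fun n => ∑' k : ℕ, p ((k + 1 : ℕ) * θseq n)) atTop (nhds 0)) := by
  have hterm : ∀ θ : ℝ, 1 ≤ θ → ∀ k : ℕ, 0 ≤ p ((k + 1 : ℕ) * θ) := fun θ hθ k =>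
    hp_nonneg _ (by positivity)
  have hbound : ∀ θ : ℝ, 1 ≤ θ →
      ∑' k : ℕ, p ((k + 1 : ℕ) * θ) ≤ Real.exp c * ∫ t in Ioi θ, p t := by
    intro θ hθ
    have hθ0 : 0 < θ := by linarith
    refine Real.tsum_le_of_sum_range_le (hterm θ hθ) fun n => ?_
    have hle : ∀ k : ℕ, ((k + 1 : ℕ) : ℝ) * θ + 1 ≤ ((k + 1 + 1 : ℕ) : ℝ) * θ := fun k => by
      push_cast; linarith
    have hadj := intervalIntegral.sum_integral_adjacent_intervals (f := p) (μ := volume)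
      (a := fun k : ℕ => ((k + 1 : ℕ) : ℝ) * θ) (n := n) fun k _ =>
        (intervalIntegrable_iff_integrableOn_Ioc_of_le (by linarith [hle k])).2
          (hp_int.mono_set fun t ht => lt_of_le_of_lt (by positivity) ht.1)
    calc ∑ k ∈ Finset.range n, p ((k + 1 : ℕ) * θ)
        ≤ ∑ k ∈ Finset.range n,
            Real.exp c * ∫ t in ((k + 1 : ℕ) * θ)..((k + 1 + 1 : ℕ) * θ), p t :=
          Finset.sum_le_sum fun k _ => le_exp_mul_intervalIntegral_of_regular hc hp_nonneg
            hp_reg hp_int (by positivity) (hle k)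
      _ = Real.exp c * ∫ t in θ..((n + 1 : ℕ) * θ), p t := by
          rw [← Finset.mul_sum, hadj]; simp
      _ ≤ Real.exp c * ∫ t in Ioi θ, p t := by
          refine mul_le_mul_of_nonneg_left ?_ (Real.exp_pos c).le
          rw [intervalIntegral.integral_of_le (by push_cast; nlinarith [n.cast_nonneg (α := ℝ)])]
          refine setIntegral_mono_set (hp_int.mono_set (Ioi_subset_Ioi hθ0.le)) ?_
            (Ioc_subset_Ioi_self.eventuallyLE)
          filter_upwards [ae_restrict_mem measurableSet_Ioi] with t ht
          exact hp_nonneg t (hθ0.trans ht).le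
  refine ⟨hbound, fun θseq hθ hlim => ?_⟩
  have htail := ((tendsto_setIntegral_Ioi_atTop_zero hp_int).comp hlim).const_mul (Real.exp c)
  rw [mul_zero] at htail
  exact squeeze_zero (fun n => tsum_nonneg (hterm _ (hθ n))) (fun n => hbound _ (hθ n)) htail
end

section
/- Let (Ω, F, ℙ) be a probability space and τ : Ω → ℝ a random variable whose tail distribution satisfies, for fixed constants α ∈ (0,1), C ∈ (0,∞), c̄ ∈ (0,∞) and a function L with L(u) → 0 as u → ∞: ℙ(τ > u) = C u^{−α}(1 + L(u)) for all u > c̄, and ℙ(τ > u) = 1 for all 0 < u ≤ c̄ (so in particular τ > c̄ almost surely). Then lim_{λ→∞} λ^{α} · E[ exp(−λ/τ) ] = C · Γ(1+α), where Γ is the Gamma function. -/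
open MeasureTheory Filter Set

/-- Layer-cake formula for `E[exp (-lam / τ)]` in terms of the tail of a positive `τ`. -/
theorem integral_exp_neg_div_eq_integral_tail
    {Ω : Type*} [MeasurableSpace Ω] (P : Measure Ω) [IsProbabilityMeasure P]
    {τ : Ω → ℝ} (hτ : Measurable τ) (hpos : ∀ᵐ ω ∂P, 0 < τ ω) {lam : ℝ} (hlam : 0 < lam) :
    ∫ ω, Real.exp (-lam / τ ω) ∂P =
      ∫ s in Ioi (0 : ℝ), Real.exp (-s) * P.real {ω | lam / s < τ ω} := by
  have hmeas : MeasurableSet {p : Ω × ℝ | lam / p.2 < τ p.1} :=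
    measurableSet_lt (measurable_const.div measurable_snd) (hτ.comp measurable_fst)
  have hint : Integrable
      ({p : Ω × ℝ | lam / p.2 < τ p.1}.indicator fun p => Real.exp (-p.2))
      (P.prod (volume.restrict (Ioi (0 : ℝ)))) := by
    refine Integrable.indicator ?_ hmeas
    exact (integrableOn_exp_neg_Ioi 0).comp_snd P
  calc ∫ ω, Real.exp (-lam / τ ω) ∂P
      = ∫ ω, (∫ s in Ioi (0 : ℝ),
          {p : Ω × ℝ | lam / p.2 < τ p.1}.indicator (fun p => Real.exp (-p.2)) (ω, s)) ∂P := by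
        refine integral_congr_ae ?_
        filter_upwards [hpos] with ω hω
        have hq : 0 < lam / τ ω := div_pos hlam hω
        have h1 : ∫ s in Ioi (0 : ℝ),
            {p : Ω × ℝ | lam / p.2 < τ p.1}.indicator (fun p => Real.exp (-p.2)) (ω, s) =
            ∫ s in Ioi (0 : ℝ), (Ioi (lam / τ ω)).indicator (fun s => Real.exp (-s)) s := by
          refine setIntegral_congr_fun measurableSet_Ioi fun s (hs : 0 < s) => ?_
          have : lam / s < τ ω ↔ lam / τ ω < s := by
            rw [div_lt_iff₀ hs, div_lt_iff₀ hω, mul_comm]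
          simp only [indicator, mem_ofPred_eq, mem_Ioi, this]
        rw [h1, setIntegral_indicator measurableSet_Ioi,
          inter_eq_self_of_subset_right (Ioi_subset_Ioi hq.le), integral_exp_neg_Ioi, neg_div]
    _ = ∫ s in Ioi (0 : ℝ), (∫ ω,
          {p : Ω × ℝ | lam / p.2 < τ p.1}.indicator (fun p => Real.exp (-p.2)) (ω, s) ∂P) :=
        integral_integral_swap hint
    _ = _ := by
        refine integral_congr_ae (Eventually.of_forall fun s => ?_)
        have hs : MeasurableSet {ω | lam / s < τ ω} := measurableSet_lt measurable_const hτ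
        have h2 := integral_indicator_const (μ := P) (Real.exp (-s)) hs
        rw [smul_eq_mul, mul_comm] at h2
        exact h2

/-- If `P (τ > u)` is asymptotic to `C u ^ (-α)` for a positive `τ`, then
`lam ^ α * E[exp (-lam / τ)]` tends to `C Γ(1 + α)`. -/
theorem tendsto_rpow_mul_integral_exp_neg_div
    {Ω : Type*} [MeasurableSpace Ω] (P : Measure Ω) [IsProbabilityMeasure P]
    {τ : Ω → ℝ} (hτ : Measurable τ) (hpos : ∀ᵐ ω ∂P, 0 < τ ω) {α C : ℝ} (hα : 0 < α)
    (htail : Tendsto (fun u : ℝ => u ^ α * P.real {ω | u < τ ω}) atTop (nhds C)) :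
    Tendsto (fun lam : ℝ => lam ^ α * ∫ ω, Real.exp (-lam / τ ω) ∂P)
      atTop (nhds (C * Real.Gamma (1 + α))) := by
  obtain ⟨K, hK⟩ : ∃ K : ℝ, ∀ u : ℝ, 0 < u → u ^ α * P.real {ω | u < τ ω} ≤ K := by
    obtain ⟨M, hM⟩ := eventually_atTop.1 (htail.eventually_le_const (lt_add_one C))
    refine ⟨max (C + 1) (M ^ α), fun u hu => ?_⟩
    rcases le_total M u with h | h
    · exact (hM u h).trans (le_max_left _ _)
    · refine le_trans ?_ (le_max_right _ _)
      calc u ^ α * P.real {ω | u < τ ω} ≤ u ^ α * 1 := by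
            gcongr
            exact measureReal_le_one
        _ ≤ M ^ α := by
            rw [mul_one]
            exact Real.rpow_le_rpow hu.le h hα.le
  have hlim : C * Real.Gamma (1 + α) =
      ∫ s in Ioi (0 : ℝ), Real.exp (-s) * s ^ α * C := by
    rw [Real.Gamma_eq_integral (by linarith), integral_mul_const, add_sub_cancel_left, mul_comm]
  have hgamma : IntegrableOn (fun s : ℝ => Real.exp (-s) * s ^ α) (Ioi 0) := by
    simpa using Real.GammaIntegral_convergent (s := 1 + α) (by linarith)
  have heq : ∀ᶠ lam : ℝ in atTop,
      ∫ s in Ioi (0 : ℝ), Real.exp (-s) * s ^ α *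
        ((lam / s) ^ α * P.real {ω | lam / s < τ ω}) =
      lam ^ α * ∫ ω, Real.exp (-lam / τ ω) ∂P := by
    filter_upwards [eventually_gt_atTop 0] with lam hlam
    rw [integral_exp_neg_div_eq_integral_tail P hτ hpos hlam, ← integral_const_mul]
    refine setIntegral_congr_fun measurableSet_Ioi fun s (hs : 0 < s) => ?_
    have := (Real.rpow_pos_of_pos hs α).ne'
    simp only [Real.div_rpow hlam.le hs.le]
    field_simp
  rw [hlim]
  refine Tendsto.congr' heq ?_
  have hanti : Antitone fun u : ℝ => P.real {ω | u < τ ω} := fun a b hab =>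
    measureReal_mono fun ω (hω : b < τ ω) => lt_of_le_of_lt hab hω
  refine tendsto_integral_filter_of_dominated_convergence
    (fun s => Real.exp (-s) * s ^ α * K) ?_ ?_ (hgamma.mul_const K) ?_
  · refine Eventually.of_forall fun lam => Measurable.aestronglyMeasurable ?_
    have h1 : Measurable fun s : ℝ => P.real {ω | lam / s < τ ω} :=
      hanti.measurable.comp (measurable_const.div measurable_id)
    fun_prop
  · filter_upwards [eventually_gt_atTop 0] with lam hlam
    filter_upwards [ae_restrict_mem measurableSet_Ioi] with s (hs : 0 < s)
    have hls : 0 < lam / s := div_pos hlam hs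
    rw [Real.norm_of_nonneg (by positivity)]
    gcongr
    exact hK _ hls
  · filter_upwards [ae_restrict_mem measurableSet_Ioi] with s (hs : 0 < s)
    exact (htail.comp (tendsto_id.atTop_div_const hs)).const_mul _

/-- Laplace-transform asymptotics for a heavy-tailed random variable: if
`ℙ(τ > u) = C u^{-α} (1 + L u)` for `u > c̄` (with `L u → 0`) and `ℙ(τ > u) = 1` for
`0 < u ≤ c̄`, then `λ^α E[exp (-λ/τ)] → C Γ(1+α)` as `λ → ∞`. -/
theorem heavyTail_laplace_asymptotics
    {Ω : Type*} [MeasurableSpace Ω] (ℙ : Measure Ω) [IsProbabilityMeasure ℙ]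
    (τ : Ω → ℝ) (hτ : Measurable τ)
    (α : ℝ) (hα : α ∈ Ioo (0 : ℝ) 1) (C : ℝ) (hC : 0 < C) (cbar : ℝ) (hcbar : 0 < cbar)
    (L : ℝ → ℝ) (hL : Tendsto L atTop (nhds 0))
    (htail : ∀ u : ℝ, cbar < u →
      (ℙ {ω | u < τ ω}).toReal = C * u ^ (-α) * (1 + L u))
    (htail' : ∀ u : ℝ, 0 < u → u ≤ cbar → ℙ {ω | u < τ ω} = 1) :
    Tendsto (fun lam : ℝ => lam ^ α * ∫ ω, Real.exp (-lam / τ ω) ∂ℙ)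
      atTop (nhds (C * Real.Gamma (1 + α))) := by
  have hpos : ∀ᵐ ω ∂ℙ, 0 < τ ω := by
    have h : ∀ᵐ ω ∂ℙ, cbar < τ ω :=
      (prob_compl_eq_zero_iff (measurableSet_lt measurable_const hτ)).2 (htail' cbar hcbar le_rfl)
    exact h.mono fun ω hω => hcbar.trans hω
  refine tendsto_rpow_mul_integral_exp_neg_div ℙ hτ hpos hα.1 ?_
  have hlim : Tendsto (fun u => C * (1 + L u)) atTop (nhds C) := by
    simpa using (hL.const_add 1).const_mul C
  refine hlim.congr' ?_
  filter_upwards [eventually_gt_atTop cbar] with u hu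
  have hu0 : 0 < u := hcbar.trans hu
  have hp := (Real.rpow_pos_of_pos hu0 α).ne'
  rw [measureReal_def, htail u hu, Real.rpow_neg hu0.le]
  field_simp
end
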